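/- Let M be a left module over the algebra Uı, and let v ∈ M be such that, for some T₀ ∈ ℕ, one has B₂^{(t)} B₁^{(b)} B₂^{(l)} w = 0 for all t, l ≥ 0 and all b > T₀, for both w = v and w = B₁v. Then q^{9/2} · k₁³ · Σ_{t,l ≥ 0} q^{−(t−l)²/2 − t − l} · k₁^{t−l} · B₂^{(t)} B₁^{(t+l)} B₂^{(l)} · (B₁ v) = q^{3/2} · B₁ · k₁⁻¹ · Σ_{t,l ≥ 0} q^{−(t−l)²/2 − t − l} · k₁^{t−l} · B₂^{(t)} B₁^{(t+l)} B₂^{(l)} · v, where both sums have only finitely many nonzero terms by the hypothesis. (This is the rank-one intertwining identity underlying the quasi-split relative braid group operator of Theorem 6.4.) -/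

import Mathlib

noncomputable section

namespace UiAIII

/-- The base field `K = ℚ(t)`, where `q := t²`. -/
abbrev K : Type := RatFunc ℚ

/-- `t^s` for `s : ℤ`; so `tz (2*n)` represents `q^n` and `tz s` represents `q^{s/2}`. -/
def tz (s : ℤ) : K := (RatFunc.X : K) ^ s

/-- The quantum integer `[n] = (q^n - q^{-n})/(q - q^{-1})`, with `q = t²`. -/
def qint (n : ℤ) : K := (tz (2 * n) - tz (-(2 * n))) / (tz 2 - tz (-2))

/-- The quantum factorial `[n]!`. -/
def qfact (n : ℕ) : K := ∏ i ∈ Finset.range n, qint ((i : ℤ) + 1)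

variable {A : Type*} [Ring A] [Algebra K A]

/-- Divided power `x^{(m)} = x^m/[m]!` for `m ≥ 0`, and `0` for `m < 0`. -/
def dp (x : A) (m : ℤ) : A := if 0 ≤ m then (qfact m.toNat)⁻¹ • x ^ m.toNat else 0

/-- `{k; s/2} := q^{s/2}·k + q^{-s/2}·k⁻¹`; the argument `s` is twice the half-integer. -/
def brace (k kinv : A) (s : ℤ) : A := tz s • k + tz (-s) • kinv

/-- `k^j` for `j : ℤ`, using the two-sided inverse `kinv` of `k`. -/
def upow (k kinv : A) (j : ℤ) : A := if 0 ≤ j then k ^ j.toNat else kinv ^ (-j).toNat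

end UiAIII

open UiAIII

namespace UiAIII

lemma tz_add (a b : ℤ) : tz (a + b) = tz a * tz b :=
  zpow_add₀ RatFunc.X_ne_zero a b

lemma tz_neg (a : ℤ) : tz (-a) = (tz a)⁻¹ := zpow_neg _ a

lemma tz_sub (a b : ℤ) : tz (a - b) = tz a * (tz b)⁻¹ := by
  rw [sub_eq_add_neg, tz_add, tz_neg]

lemma tz_mul_nat (a : ℤ) (n : ℕ) : tz (n * a) = tz a ^ n := by
  rw [mul_comm]; exact zpow_mul _ a n |>.trans (zpow_natCast _ n)

@[simp] lemma tz_zero : tz 0 = 1 := zpow_zero _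

lemma tz_ne_zero (a : ℤ) : tz a ≠ 0 := zpow_ne_zero a RatFunc.X_ne_zero

lemma tz_two_mul (a : ℤ) : tz (2 * a) = tz a ^ 2 := tz_mul_nat a 2

lemma tz_two : tz 2 = tz 1 ^ 2 := tz_two_mul 1

lemma tz_three : tz 3 = tz 1 ^ 3 := tz_mul_nat 1 3

lemma tz_four : tz 4 = tz 1 ^ 4 := tz_mul_nat 1 4

lemma tz_five : tz 5 = tz 1 ^ 5 := tz_mul_nat 1 5

lemma tz_six : tz 6 = tz 1 ^ 6 := tz_mul_nat 1 6

lemma tz_mul_six (a : ℤ) : tz (a * 6) = tz a ^ 6 := by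
  rw [mul_comm]; exact tz_mul_nat a 6

lemma tz_natCast_ne_one {n : ℕ} (hn : n ≠ 0) : tz n ≠ 1 := by
  intro h
  have h' : algebraMap (Polynomial ℚ) K (Polynomial.X ^ n) = algebraMap (Polynomial ℚ) K 1 := by
    simpa [tz, RatFunc.algebraMap_X] using h
  have := congrArg Polynomial.natDegree (RatFunc.algebraMap_injective ℚ h')
  simp at this
  exact hn this

lemma tz_sub_tz_neg_ne_zero {n : ℕ} (hn : n ≠ 0) : tz n - tz (-n) ≠ 0 := by
  intro h
  have h1 := tz_natCast_ne_one (n := n + n) (by omega)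
  rw [Nat.cast_add, tz_add] at h1
  rw [sub_eq_zero, tz_neg] at h
  apply h1
  nth_rewrite 1 [h]
  exact inv_mul_cancel₀ (tz_ne_zero _)

lemma qint_denom_ne_zero : tz 2 - tz (-2) ≠ 0 := tz_sub_tz_neg_ne_zero (n := 2) two_ne_zero

lemma qint_natCast_ne_zero {n : ℕ} (hn : n ≠ 0) : qint n ≠ 0 := by
  refine div_ne_zero ?_ qint_denom_ne_zero
  simpa using tz_sub_tz_neg_ne_zero (n := 2 * n) (by omega)

@[simp] lemma qint_zero : qint 0 = 0 := by simp [qint]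

@[simp] lemma qint_one : qint 1 = 1 := by
  simpa [qint] using div_self qint_denom_ne_zero

lemma qint_neg (n : ℤ) : qint (-n) = -qint n := by
  simp only [qint, mul_neg, neg_neg]; ring

lemma tz_one_ne : tz 1 ^ 4 - 1 ≠ 0 := by
  rw [← tz_mul_nat, mul_one]
  exact sub_ne_zero.2 (tz_natCast_ne_one (n := 4) (by norm_num))

/-- A quantum integer in terms of `x = q^{n/2}` and `t`, with all exponents cleared. -/
lemma qint_eq (n : ℤ) :
    qint n = (tz n ^ 4 - 1) * tz 1 ^ 2 / (tz n ^ 2 * (tz 1 ^ 4 - 1)) := by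
  have h0 := tz_ne_zero n
  have h1 := tz_ne_zero 1
  have h2 := tz_one_ne
  have h3 := qint_denom_ne_zero
  rw [qint, div_eq_div_iff h3 (by positivity)]
  rw [tz_neg, tz_neg, tz_two_mul, tz_two]
  field_simp

lemma qint_mul_sub (n t : ℤ) :
    qint n * qint t - qint (t - 1) * qint (n + 1) = qint (n - t + 1) := by
  have h1 := tz_ne_zero 1
  have h2 := tz_one_ne
  have hn := tz_ne_zero n
  have ht := tz_ne_zero t
  simp only [qint_eq, tz_add, tz_sub]
  field_simp
  ring

lemma qint_succ (n : ℤ) : qint (n + 1) = tz 2 * qint n + tz (-(2 * n)) := by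
  have h1 := tz_ne_zero 1
  have h2 := tz_one_ne
  have hn := tz_ne_zero n
  simp only [qint_eq, tz_add, tz_neg, tz_two_mul, tz_two]
  field_simp
  ring

lemma qint_sub_tz_mul (a b : ℤ) :
    qint a - tz (2 * b) * qint (a + b) = -(tz (2 * (a + b)) * qint b) := by
  have h1 := tz_ne_zero 1
  have h2 := tz_one_ne
  have ha := tz_ne_zero a
  have hb := tz_ne_zero b
  simp only [qint_eq, tz_add, tz_two_mul]
  field_simp
  ring

lemma qint_sub_tz_neg_mul (a b : ℤ) :
    qint a - tz (-(2 * b)) * qint (a + b) = -(tz (-(2 * (a + b))) * qint b) := by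
  have := qint_sub_tz_mul (-a) (-b)
  rw [← neg_add, qint_neg, qint_neg, qint_neg, mul_neg, mul_neg] at this
  rw [mul_neg (2 : ℤ)] at this
  linear_combination -this

lemma qint_add_two_mul (n : ℤ) :
    qint (n + 2) * tz (2 * n) = tz 4 * qint n * tz (2 * n) + qint 2 := by
  have h1 := tz_ne_zero 1
  have h2 := tz_one_ne
  have hn := tz_ne_zero n
  simp only [qint_eq, tz_add, tz_two_mul, tz_two, tz_four]
  field_simp
  ring

lemma qint_add_two_mul' (n : ℤ) :
    qint (n + 2) * tz (-(2 * n)) = tz (-4) * qint n * tz (-(2 * n)) + qint 2 := by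
  have h1 := tz_ne_zero 1
  have h2 := tz_one_ne
  have hn := tz_ne_zero n
  simp only [qint_eq, tz_add, tz_neg, tz_two_mul, tz_two, tz_four]
  field_simp
  ring

lemma qint_mul_two_sub (n : ℤ) : qint n * qint 2 - qint (n - 1) = qint (n + 1) := by
  have := qint_mul_sub n 2
  rw [show (2 : ℤ) - 1 = 1 by norm_num, show n - 2 + 1 = n - 1 by ring, qint_one] at this
  linear_combination this

/-- The defining relations of the iquantum group, with `k` and `kinv` mutually inverse. -/
structure IsIquantum {A : Type*} [Ring A] [Algebra K A] (B1 B2 k kinv : A) : Prop where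
  mul_inv : k * kinv = 1
  inv_mul : kinv * k = 1
  k_mul_B1 : k * B1 = tz (-6) • (B1 * k)
  k_mul_B2 : k * B2 = tz 6 • (B2 * k)
  serre1 : B1 ^ 2 * B2 - qint 2 • (B1 * B2 * B1) + B2 * B1 ^ 2
    = qint 2 • (B1 * (tz (-3) • k + tz 3 • kinv))
  serre2 : B2 ^ 2 * B1 - qint 2 • (B2 * B1 * B2) + B1 * B2 ^ 2
    = qint 2 • (B2 * (tz 3 • k + tz (-3) • kinv))

/-- Takes precedence over the algebra structure coming from polynomials, so that `match_scalars`
applies over `K`. -/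
local instance instAlgebraNatK : Algebra ℕ K := Semiring.toNatAlgebra

/-- Takes precedence over the algebra structure coming from polynomials, so that `match_scalars`
applies over `K`. -/
local instance instAlgebraIntK : Algebra ℤ K := Ring.toIntAlgebra K

section DividedPower

variable {A : Type*} [Ring A] [Algebra K A]

lemma dp_natCast (x : A) (n : ℕ) : dp x n = (qfact n)⁻¹ • x ^ n := by
  simp [dp]

lemma dp_of_neg (x : A) {n : ℤ} (hn : n < 0) : dp x n = 0 := if_neg (by omega)

@[simp] lemma dp_zero (x : A) : dp x 0 = 1 := by
  simp [dp, qfact]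

lemma qfact_succ (n : ℕ) : qfact (n + 1) = qfact n * qint (n + 1) := by
  rw [qfact, Finset.prod_range_succ, ← qfact]

lemma qfact_ne_zero (n : ℕ) : qfact n ≠ 0 :=
  Finset.prod_ne_zero_iff.2 fun i _ => by exact_mod_cast qint_natCast_ne_zero i.succ_ne_zero

lemma dp_mul_self (x : A) (n : ℤ) : dp x n * x = qint (n + 1) • dp x (n + 1) := by
  obtain hn | hn := lt_or_ge n 0
  · rw [dp_of_neg x hn, zero_mul]
    obtain rfl | hn' := eq_or_ne n (-1)
    · simp
    · rw [dp_of_neg x (by omega), smul_zero]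
  · lift n to ℕ using hn
    have h : qint (n + 1) ≠ 0 := by exact_mod_cast qint_natCast_ne_zero n.succ_ne_zero
    rw [dp_natCast, ← Nat.cast_succ, dp_natCast, Nat.succ_eq_add_one, qfact_succ, smul_mul_assoc,
      ← pow_succ, smul_smul, Nat.cast_add, Nat.cast_one, mul_inv, mul_left_comm,
      mul_inv_cancel₀ h, mul_one]

lemma self_mul_dp (x : A) (n : ℤ) : x * dp x n = qint (n + 1) • dp x (n + 1) := by
  rw [← dp_mul_self]
  unfold dp
  split_ifs
  · rw [mul_smul_comm, smul_mul_assoc, ← pow_succ, ← pow_succ']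
  · simp

lemma dp_op (x : A) (n : ℤ) : dp (MulOpposite.op x) n = MulOpposite.op (dp x n) := by
  unfold dp
  split_ifs <;> simp

lemma mul_pow_of_mul_eq {k x : A} {s : ℤ} (h : k * x = tz s • (x * k)) (n : ℕ) :
    k * x ^ n = tz (n * s) • (x ^ n * k) := by
  induction n with
  | zero => simp
  | succ n ih =>
    rw [pow_succ, ← mul_assoc, ih, smul_mul_assoc, mul_assoc, h, mul_smul_comm, smul_smul,
      ← tz_add, mul_assoc, Nat.cast_succ, add_one_mul]

lemma mul_dp_of_mul_eq {k x : A} {s : ℤ} (h : k * x = tz s • (x * k)) (n : ℤ) :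
    k * dp x n = tz (n * s) • (dp x n * k) := by
  obtain hn | hn := lt_or_ge n 0
  · simp [dp_of_neg x hn]
  · lift n to ℕ using hn
    rw [dp_natCast, mul_smul_comm, mul_pow_of_mul_eq h, smul_mul_assoc, smul_comm]

lemma dp_mul_of_mul_eq {k x : A} {s : ℤ} (h : k * x = tz s • (x * k)) (n : ℤ) :
    dp x n * k = tz (-(n * s)) • (k * dp x n) := by
  rw [mul_dp_of_mul_eq h, smul_smul, ← tz_add, neg_add_cancel, tz_zero, one_smul]

end DividedPower

namespace IsIquantum

open MulOpposite

variable {A : Type*} [Ring A] [Algebra K A] {B1 B2 k kinv : A}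

lemma inv_mul_of_mul_eq (h : IsIquantum B1 B2 k kinv) {x : A} {s : ℤ}
    (hx : k * x = tz s • (x * k)) : kinv * x = tz (-s) • (x * kinv) := by
  calc kinv * x = tz (-s) • (kinv * (tz s • (x * k)) * kinv) := by
        rw [mul_smul_comm, smul_mul_assoc, smul_smul, ← tz_add, neg_add_cancel, tz_zero, one_smul,
          mul_assoc, mul_assoc, h.mul_inv, mul_one]
    _ = tz (-s) • (x * kinv) := by
        rw [← hx, ← mul_assoc kinv, h.inv_mul, one_mul]

lemma kinv_mul_B1 (h : IsIquantum B1 B2 k kinv) : kinv * B1 = tz 6 • (B1 * kinv) :=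
  h.inv_mul_of_mul_eq h.k_mul_B1

lemma kinv_mul_B2 (h : IsIquantum B1 B2 k kinv) : kinv * B2 = tz (-6) • (B2 * kinv) :=
  h.inv_mul_of_mul_eq h.k_mul_B2

/-- The automorphism exchanging `B1` with `B2` and `k` with `kinv`. -/
lemma swap (h : IsIquantum B1 B2 k kinv) : IsIquantum B2 B1 kinv k where
  mul_inv := h.inv_mul
  inv_mul := h.mul_inv
  k_mul_B1 := h.kinv_mul_B2
  k_mul_B2 := h.kinv_mul_B1
  serre1 := by rw [h.serre2, add_comm]
  serre2 := by rw [h.serre1, add_comm]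

lemma smul_mul_comm (h : IsIquantum B1 B2 k kinv) :
    (tz 3 • k + tz (-3) • kinv) * B1 = B1 * (tz (-3) • k + tz 3 • kinv) := by
  simp only [add_mul, mul_add, smul_mul_assoc, mul_smul_comm, h.k_mul_B1, h.kinv_mul_B1,
    smul_smul, ← tz_add]
  norm_num

/-- The anti-automorphism fixing `B1` and `B2` and exchanging `k` with `kinv`. -/
lemma op (h : IsIquantum B1 B2 k kinv) : IsIquantum (op B1) (op B2) (op kinv) (op k) where
  mul_inv := by rw [← op_mul, h.mul_inv, op_one]
  inv_mul := by rw [← op_mul, h.inv_mul, op_one]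
  k_mul_B1 := by
    rw [← op_mul, ← op_mul, h.kinv_mul_B1, op_smul, smul_smul, ← tz_add]
    simp
  k_mul_B2 := by
    rw [← op_mul, ← op_mul, h.kinv_mul_B2, op_smul, smul_smul, ← tz_add]
    simp
  serre1 := by
    have := congrArg MulOpposite.op h.serre1
    rw [← h.smul_mul_comm] at this
    simp only [op_add, op_sub, op_mul, op_smul, op_pow] at this ⊢
    rw [add_comm (tz (-3) • _), ← this, mul_assoc]
    abel
  serre2 := by
    have := congrArg MulOpposite.op h.serre2
    rw [add_comm (tz 3 • k), ← h.swap.smul_mul_comm] at this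
    simp only [op_add, op_sub, op_mul, op_smul, op_pow] at this ⊢
    rw [← this, mul_assoc]
    abel

lemma B1_mul_pow (h : IsIquantum B1 B2 k kinv) (n : ℕ) :
    B1 * B2 ^ (n + 1) = qint (n + 1) • (B2 ^ n * (B1 * B2)) - qint n • (B2 ^ (n + 1) * B1)
      + (qint (n + 1) * qint n) •
        (B2 ^ n * (tz (2 * n + 1) • k + tz (-(2 * n + 1)) • kinv)) := by
  induction n with
  | zero => simp
  | succ n ih =>
    have e : B1 * B2 * B2 = qint 2 • (B2 * (B1 * B2)) - B2 ^ 2 * B1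
        + qint 2 • (B2 * (tz 3 • k + tz (-3) • kinv)) := by
      rw [← h.serre2, mul_assoc, mul_assoc]; noncomm_ring
    have h1 := qint_mul_two_sub (n + 1)
    have h2 := qint_add_two_mul n
    have h3 := qint_add_two_mul' n
    rw [pow_succ B2 (n + 1), ← mul_assoc, ih]
    simp only [add_mul, sub_mul, smul_mul_assoc, mul_assoc, h.k_mul_B2, h.kinv_mul_B2, smul_add,
      mul_smul_comm, mul_add, smul_smul] at e ⊢
    rw [e]
    simp only [pow_succ, mul_add, mul_sub, mul_smul_comm, mul_assoc, pow_zero, one_mul]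
    push_cast
    rw [add_sub_cancel_right, add_assoc, one_add_one_eq_two] at h1
    rw [add_assoc (n : ℤ), one_add_one_eq_two, mul_add_one]
    simp only [tz_add, tz_neg, tz_two_mul, tz_two, tz_three, tz_four, tz_six] at h2 h3 ⊢
    match_scalars
    · linear_combination h1
    · ring
    · linear_combination (-qint (n + 1) * tz 1 ^ 3) * h2
    · linear_combination (-qint (n + 1) * (tz 1 ^ 3)⁻¹) * h3

lemma B1_mul_dp (h : IsIquantum B1 B2 k kinv) (n : ℤ) :
    B1 * dp B2 n = dp B2 (n - 1) * (B1 * B2) - qint (n - 1) • (dp B2 n * B1)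
      + qint (n - 1) • (dp B2 (n - 1) * (tz (2 * n - 1) • k + tz (-(2 * n - 1)) • kinv)) := by
  obtain hn | rfl | hn := lt_trichotomy n 0
  · simp [dp_of_neg _ hn, dp_of_neg _ (show n - 1 < 0 by omega)]
  · simp [dp_of_neg, qint_neg]
  · obtain ⟨m, rfl⟩ : ∃ m : ℕ, n = (m + 1 : ℕ) := ⟨(n - 1).toNat, by omega⟩
    have hq : qint ((m : ℤ) + 1) ≠ 0 := by exact_mod_cast qint_natCast_ne_zero m.succ_ne_zero
    have hf := qfact_ne_zero m
    rw [dp_natCast, mul_smul_comm, h.B1_mul_pow, qfact_succ]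
    rw [show ((m + 1 : ℕ) : ℤ) - 1 = m by push_cast; ring, dp_natCast]
    rw [show 2 * ((m + 1 : ℕ) : ℤ) - 1 = 2 * m + 1 by push_cast; ring]
    simp only [smul_mul_assoc]
    match_scalars <;> field_simp

lemma B1_mul_B2_mul_dp (h : IsIquantum B1 B2 k kinv) (n : ℤ) :
    B1 * B2 * dp B1 n = dp B1 (n + 1) * B2 + qint n • (B2 * dp B1 (n + 1))
      - qint n • ((tz (2 * n + 1) • k + tz (-(2 * n + 1)) • kinv) * dp B1 n) := by
  have := congrArg unop (h.swap.op.B1_mul_dp (n + 1))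
  simp only [add_sub_cancel_right, dp_op, ← op_mul, ← op_smul, ← op_add, ← op_sub, unop_op] at this
  rw [this, show 2 * (n + 1) - 1 = 2 * n + 1 by ring]
  abel

/-- Left multiplication by `B1` on `B2^{(t)} B1^{(t+l)} B2^{(l)}`. -/
lemma B1_mul_dp_mul_dp_mul_dp (h : IsIquantum B1 B2 k kinv) (t l : ℤ) :
    B1 * (dp B2 t * dp B1 (t + l) * dp B2 l) = qint (l + 1) •
      (dp B2 t * dp B1 (t + l + 1) * dp B2 l + dp B2 (t - 1) * dp B1 (t + l + 1) * dp B2 (l + 1)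
        - (tz (5 - 2 * t + 2 * l) • k + tz (-(5 - 2 * t + 2 * l)) • kinv) *
          (dp B2 (t - 1) * dp B1 (t + l) * dp B2 l)) := by
  have e1 := qint_mul_sub (t + l) t
  have e2 := qint_sub_tz_mul (t - 1) (l + 1)
  have e3 := qint_sub_tz_neg_mul (t - 1) (l + 1)
  have hB2 (x : A) : dp B2 (t - 1) * (B2 * x) = qint t • (dp B2 t * x) := by
    rw [← mul_assoc, dp_mul_self, sub_add_cancel, smul_mul_assoc]
  have hk (x : A) : dp B2 (t - 1) * (k * x) = tz (-((t - 1) * 6)) • (k * (dp B2 (t - 1) * x)) := by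
    rw [← mul_assoc, dp_mul_of_mul_eq h.k_mul_B2, smul_mul_assoc, mul_assoc]
  have hk' (x : A) :
      dp B2 (t - 1) * (kinv * x) = tz ((t - 1) * 6) • (kinv * (dp B2 (t - 1) * x)) := by
    rw [← mul_assoc, dp_mul_of_mul_eq h.kinv_mul_B2, smul_mul_assoc, mul_assoc, mul_neg, neg_neg]
  have hX : dp B2 (t - 1) * (B1 * B2) * dp B1 (t + l) =
      dp B2 (t - 1) * (B1 * B2 * dp B1 (t + l)) := mul_assoc _ _ _
  rw [← mul_assoc, ← mul_assoc, h.B1_mul_dp]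
  simp only [add_mul, sub_mul, smul_mul_assoc]
  rw [hX, h.B1_mul_B2_mul_dp, mul_assoc (dp B2 t) B1, self_mul_dp]
  simp only [add_mul, sub_mul, mul_add, mul_sub, smul_mul_assoc, mul_smul_comm, mul_assoc, hB2,
    hk, hk', self_mul_dp, smul_sub, smul_add, smul_smul]
  rw [show t + l - t + 1 = l + 1 by ring] at e1
  rw [show t - 1 + (l + 1) = t + l by ring] at e2 e3
  match_scalars
  · ring
  · linear_combination e1
  · have ht := tz_ne_zero t
    have h1 := tz_ne_zero 1
    simp only [tz_add, tz_sub, tz_neg, tz_two_mul, tz_mul_six, tz_five] at e2 ⊢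
    field_simp at e2 ⊢
    linear_combination e2
  · have ht := tz_ne_zero t
    have hl := tz_ne_zero l
    have h1 := tz_ne_zero 1
    simp only [tz_add, tz_sub, tz_neg, tz_two_mul, tz_mul_six, tz_five, one_mul, tz_six] at e3 ⊢
    field_simp at e3 ⊢
    linear_combination e3

/-- The image of `B1_mul_dp_mul_dp_mul_dp` under the anti-automorphism `op`. -/
lemma dp_mul_dp_mul_dp_mul_B1 (h : IsIquantum B1 B2 k kinv) (t l : ℤ) :
    dp B2 t * dp B1 (t + l) * dp B2 l * B1 = qint (t + 1) •
      (dp B2 t * dp B1 (t + l + 1) * dp B2 l + dp B2 (t + 1) * dp B1 (t + l + 1) * dp B2 (l - 1)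
        - (tz (1 + 2 * l - 2 * t) • k + tz (-(1 + 2 * l - 2 * t)) • kinv) *
          (dp B2 t * dp B1 (t + l) * dp B2 (l - 1))) := by
  have key := congrArg unop (h.op.B1_mul_dp_mul_dp_mul_dp l t)
  simp only [dp_op, ← op_mul, ← op_smul, ← op_add, ← op_sub, unop_op] at key
  have comm {x : A} {s : ℤ} (h1 : x * B1 = tz (-s) • (B1 * x)) (h2 : x * B2 = tz s • (B2 * x)) :
      dp B2 t * dp B1 (t + l) * dp B2 (l - 1) * x =
        tz s • (x * (dp B2 t * dp B1 (t + l) * dp B2 (l - 1))) := by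
    rw [mul_assoc, dp_mul_of_mul_eq h2, mul_smul_comm, ← mul_assoc, mul_assoc (dp B2 t),
      dp_mul_of_mul_eq h1, mul_smul_comm, smul_mul_assoc, smul_smul, ← mul_assoc,
      dp_mul_of_mul_eq h2]
    simp only [smul_mul_assoc, smul_smul, ← tz_add, mul_assoc]
    congr 2
    ring
  have hk := comm h.k_mul_B1 h.k_mul_B2
  have hk' := comm (s := -6) (by simpa using h.kinv_mul_B1) h.kinv_mul_B2
  rw [add_comm l t] at key
  simp only [← mul_assoc] at key
  rw [key, mul_add, mul_smul_comm, mul_smul_comm, hk, hk', smul_smul, smul_smul, ← tz_add,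
    ← tz_add, add_mul, smul_mul_assoc, smul_mul_assoc, add_comm (tz (1 + 2 * l - 2 * t) • _)]
  ring_nf

lemma upow_eq_zpow (h : IsIquantum B1 B2 k kinv) (j : ℤ) :
    upow k kinv j = ((⟨k, kinv, h.mul_inv, h.inv_mul⟩ : Aˣ) ^ j : Aˣ) := by
  unfold upow
  split_ifs with hj
  · lift j to ℕ using hj
    simp
  · obtain ⟨n, rfl⟩ : ∃ n : ℕ, j = -n := ⟨(-j).toNat, by omega⟩
    simp [← inv_pow, Units.inv_mk]

lemma upow_add (h : IsIquantum B1 B2 k kinv) (i j : ℤ) :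
    upow k kinv (i + j) = upow k kinv i * upow k kinv j := by
  simp only [h.upow_eq_zpow, zpow_add, Units.val_mul]

lemma upow_mul_k (h : IsIquantum B1 B2 k kinv) (j : ℤ) :
    upow k kinv j * k = upow k kinv (j + 1) := by
  rw [h.upow_add]
  simp [upow]

lemma upow_mul_kinv (h : IsIquantum B1 B2 k kinv) (j : ℤ) :
    upow k kinv j * kinv = upow k kinv (j - 1) := by
  rw [sub_eq_add_neg, h.upow_add]
  simp [upow]

lemma k_pow_mul_upow (h : IsIquantum B1 B2 k kinv) (j : ℤ) :
    k ^ 3 * upow k kinv j = upow k kinv (j + 3) := by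
  rw [add_comm, h.upow_add]
  simp [upow]

lemma kinv_mul_upow (h : IsIquantum B1 B2 k kinv) (j : ℤ) :
    kinv * upow k kinv j = upow k kinv (j - 1) := by
  rw [sub_eq_neg_add, h.upow_add]
  simp [upow]

lemma B1_mul_upow (h : IsIquantum B1 B2 k kinv) (j : ℤ) :
    B1 * upow k kinv j = tz (j * 6) • (upow k kinv j * B1) := by
  have comm {x : A} {s : ℤ} (hx : x * B1 = tz (-s) • (B1 * x)) (n : ℕ) :
      B1 * x ^ n = tz (n * s) • (x ^ n * B1) :=
    mul_pow_of_mul_eq (by rw [hx, smul_smul, ← tz_add, add_neg_cancel, tz_zero, one_smul]) n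
  unfold upow
  split_ifs with hj
  · lift j to ℕ using hj
    exact comm h.k_mul_B1 j
  · obtain ⟨n, rfl⟩ : ∃ n : ℕ, j = -n := ⟨(-j).toNat, by omega⟩
    simpa using comm (s := -6) (by simpa using h.kinv_mul_B1) n

end IsIquantum

/-- The element `k^p B2^{(t)} B1^{(t+l+1)} B2^{(l)}`. -/
def oddMonomial {A : Type*} [Ring A] [Algebra K A] (B1 B2 k kinv : A) (p t l : ℤ) : A :=
  upow k kinv p * (dp B2 t * dp B1 (t + l + 1) * dp B2 l)

namespace IsIquantum

variable {A : Type*} [Ring A] [Algebra K A] {B1 B2 k kinv : A}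

lemma kinv_smul_term (h : IsIquantum B1 B2 k kinv) (t l : ℤ) (F F' G : ℤ → ℤ → A)
    (hF : F = fun t l => (qint (l + 1) * tz (6 * (t - l) - 3 - (t - l) ^ 2 - 2 * (t + l))) •
      oddMonomial B1 B2 k kinv (t - l - 1) t l)
    (hF' : F' = fun t l => (qint l * tz (2 * (t - l) + 5 - (t - l) ^ 2 - 2 * (t + l))) •
      oddMonomial B1 B2 k kinv (t - l + 1) t l)
    (hG : G = fun t l => (qint (l + 1) * tz (2 * (t - l) + 3 - (t - l) ^ 2 - 2 * (t + l))) •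
      oddMonomial B1 B2 k kinv (t - l + 1) t l) :
    tz 3 • (B1 * kinv) * (tz (-(t - l) ^ 2 - 2 * t - 2 * l) •
      (upow k kinv (t - l) * (dp B2 t * dp B1 (t + l) * dp B2 l))) =
    F t l + F' (t - 1) (l + 1) - G (t - 1) l - F (t - 1) l := by
  rw [smul_mul_smul_comm, mul_assoc, ← mul_assoc kinv, h.kinv_mul_upow, ← mul_assoc, h.B1_mul_upow,
    smul_mul_assoc, mul_assoc, h.B1_mul_dp_mul_dp_mul_dp]
  subst hF hF' hG
  simp only [oddMonomial, mul_smul_comm, mul_add, mul_sub, add_mul, smul_mul_assoc, smul_smul,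
    ← mul_assoc, h.upow_mul_k, h.upow_mul_kinv, sub_add_cancel]
  rw [show t - 1 + (l + 1) = t + l by ring, show t - 1 + l + 1 = t + l by ring,
    show t - 1 - l - 1 = t - l - 1 - 1 by ring, show t - 1 - l + 1 = t - l by ring,
    show t - 1 - (l + 1) + 1 = t - l - 1 by ring]
  match_scalars <;> simp only [mul_neg, mul_one, mul_right_comm _ (qint _), ← tz_add] <;> ring_nf

lemma k_pow_smul_term_mul_B1 (h : IsIquantum B1 B2 k kinv) (t l : ℤ) (F F' G : ℤ → ℤ → A)
    (hF : F = fun t l => (qint (t + 1) * tz (9 - (t - l) ^ 2 - 2 * (t + l))) •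
      oddMonomial B1 B2 k kinv (t - l + 3) t l)
    (hF' : F' = fun t l => (qint t * tz (4 * (t - l) + 5 - (t - l) ^ 2 - 2 * (t + l))) •
      oddMonomial B1 B2 k kinv (t - l + 1) t l)
    (hG : G = fun t l => (qint (t + 1) * tz (4 * (t - l) + 3 - (t - l) ^ 2 - 2 * (t + l))) •
      oddMonomial B1 B2 k kinv (t - l + 1) t l) :
    tz 9 • k ^ 3 * (tz (-(t - l) ^ 2 - 2 * t - 2 * l) •
      (upow k kinv (t - l) * (dp B2 t * dp B1 (t + l) * dp B2 l))) * B1 =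
    F t l + F' (t + 1) (l - 1) - G t (l - 1) - F t (l - 1) := by
  rw [smul_mul_smul_comm, ← mul_assoc, h.k_pow_mul_upow, smul_mul_assoc, mul_assoc,
    h.dp_mul_dp_mul_dp_mul_B1]
  subst hF hF' hG
  simp only [oddMonomial, mul_smul_comm, mul_add, mul_sub, add_mul, smul_mul_assoc, smul_smul,
    ← mul_assoc, h.upow_mul_k, h.upow_mul_kinv]
  rw [show t + 1 + (l - 1) = t + l by ring, show t + (l - 1) + 1 = t + l by ring,
    show t - (l - 1) + 3 = t - l + 3 + 1 by ring, show t - (l - 1) + 1 = t - l + 3 - 1 by ring,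
    show t + 1 - (l - 1) + 1 = t - l + 3 by ring]
  match_scalars <;> simp only [mul_neg, mul_one, mul_right_comm _ (qint _), ← tz_add] <;> ring_nf

/-- The common summand to which both sides of the intertwining identity telescope. -/
lemma telescoped_coeff (t l : ℤ) :
    qint l * tz (2 * (t - l) + 5 - (t - l) ^ 2 - 2 * (t + l)) -
      qint (l + 1) * tz (2 * (t - l) + 3 - (t - l) ^ 2 - 2 * (t + l)) =
    qint t * tz (4 * (t - l) + 5 - (t - l) ^ 2 - 2 * (t + l)) -
      qint (t + 1) * tz (4 * (t - l) + 3 - (t - l) ^ 2 - 2 * (t + l)) := by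
  have ht := tz_ne_zero t
  have hl := tz_ne_zero l
  rw [qint_succ, qint_succ, show 4 * (t - l) = 2 * (t - l) + 2 * (t - l) by ring]
  simp only [tz_add, tz_sub, tz_neg, tz_two_mul, tz_five, tz_three, tz_two]
  field_simp
  ring

end IsIquantum

section Finsum

variable {M : Type*} [AddCommGroup M]

lemma finsum_natCast_natCast {f : ℤ × ℤ → M} (hf : f.HasFiniteSupport)
    (h0 : ∀ p, p.1 < 0 ∨ p.2 < 0 → f p = 0) :
    ∑ᶠ t : ℕ, ∑ᶠ l : ℕ, f (t, l) = ∑ᶠ p, f p := by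
  set g : ℕ × ℕ → ℤ × ℤ := Prod.map (↑) (↑) with hg
  have hinj : g.Injective := Nat.cast_injective.prodMap Nat.cast_injective
  rw [← finsum_mem_univ f, ← finsum_mem_inter_support_eq' f (Set.range g), finsum_mem_range hinj,
    finsum_curry]
  · rfl
  · exact hf.preimage hinj.injOn
  · rintro ⟨t, l⟩ hp
    have : 0 ≤ t ∧ 0 ≤ l := by
      by_contra! H
      exact hp (h0 (t, l) (by by_cases 0 ≤ t <;> simp <;> grind))
    simp only [Set.mem_univ, iff_true]
    exact ⟨(t.toNat, l.toNat), by simp [hg, this.1, this.2]⟩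

lemma finsum_telescope {P : Type*} [AddGroup P] {F F' G : P → M} (hF : F.HasFiniteSupport)
    (hF' : F'.HasFiniteSupport) (hG : G.HasFiniteSupport) (a b : P) :
    ∑ᶠ p, (F p + F' (p + a) - G (p + b) - F (p + b)) = ∑ᶠ p, (F' p - G p) := by
  have shift (f : P → M) (c : P) : ∑ᶠ p, f (p + c) = ∑ᶠ p, f p :=
    finsum_comp_equiv (Equiv.addRight c)
  have fin {f : P → M} (hf : f.HasFiniteSupport) (c : P) : (fun p => f (p + c)).HasFiniteSupport :=
    Set.Finite.preimage (add_left_injective c).injOn hf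
  rw [finsum_sub_distrib ((hF.fun_add (fin hF' a)).fun_sub (fin hG b)) (fin hF b),
    finsum_sub_distrib (hF.fun_add (fin hF' a)) (fin hG b), finsum_add_distrib hF (fin hF' a),
    finsum_sub_distrib hF' hG, shift, shift, shift]
  abel

lemma hasFiniteSupport_of_triangle {f : ℤ × ℤ → M} (N : ℤ)
    (h0 : ∀ p, p.1 < 0 ∨ p.2 < 0 ∨ N < p.1 + p.2 → f p = 0) : f.HasFiniteSupport := by
  refine (Set.finite_Icc ((0 : ℤ), (0 : ℤ)) (N, N)).subset fun p hp => ?_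
  have := mt (h0 p) hp
  simp only [Set.mem_Icc, Prod.le_def]
  omega

end Finsum

section Module

variable {A : Type*} [Ring A] [Algebra K A] {B1 B2 k kinv : A} {M : Type*} [AddCommGroup M]
  [Module A M]

lemma dp_mul_dp_mul_dp_smul_eq_zero {v : M} {T0 : ℕ}
    (hv : ∀ t l b : ℕ, T0 < b →
      (dp B2 (t : ℤ) * dp B1 (b : ℤ) * dp B2 (l : ℤ)) • v = 0)
    {t l b : ℤ} (h : t < 0 ∨ l < 0 ∨ (T0 : ℤ) < b) : (dp B2 t * dp B1 b * dp B2 l) • v = 0 := by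
  obtain ht | ht := lt_or_ge t 0
  · simp [dp_of_neg _ ht]
  obtain hl | hl := lt_or_ge l 0
  · simp [dp_of_neg _ hl]
  lift t to ℕ using ht
  lift l to ℕ using hl
  lift b to ℕ using by omega
  exact hv t l b (by omega)

lemma smul_mul_smul_eq_zero (c : K) (a : A) {x : A} {v : M} (h : x • v = 0) :
    (c • (a * x)) • v = 0 := by
  rw [← smul_mul_assoc, mul_smul, h, smul_zero]

lemma smul_finsum_eq_finsum_telescoped {w v : M} (a y : A) (hw : w = y • v) (T0 : ℕ)
    (hv : ∀ t l b : ℕ, T0 < b →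
      (dp B2 (t : ℤ) * dp B1 (b : ℤ) * dp B2 (l : ℤ)) • v = 0)
    (hw0 : ∀ t l b : ℕ, T0 < b →
      (dp B2 (t : ℤ) * dp B1 (b : ℤ) * dp B2 (l : ℤ)) • w = 0)
    {F F' G : ℤ → ℤ → A} {cF cF' cG : ℤ → ℤ → K} {pF pF' pG : ℤ → ℤ → ℤ}
    (hF : F = fun t l => cF t l • oddMonomial B1 B2 k kinv (pF t l) t l)
    (hF' : F' = fun t l => cF' t l • oddMonomial B1 B2 k kinv (pF' t l) t l)
    (hG : G = fun t l => cG t l • oddMonomial B1 B2 k kinv (pG t l) t l)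
    (i j r s : ℤ)
    (hterm : ∀ t l : ℤ, a * (tz (-(t - l) ^ 2 - 2 * t - 2 * l) •
      (upow k kinv (t - l) * (dp B2 t * dp B1 (t + l) * dp B2 l))) * y =
        F t l + F' (t + i) (l + j) - G (t + r) (l + s) - F (t + r) (l + s)) :
    a • (∑ᶠ t : ℕ, ∑ᶠ l : ℕ,
      (tz (-(((t : ℤ) - (l : ℤ)) ^ 2) - 2 * (t : ℤ) - 2 * (l : ℤ)) •
        (upow k kinv ((t : ℤ) - (l : ℤ)) *
          (dp B2 (t : ℤ) * dp B1 ((t : ℤ) + (l : ℤ)) * dp B2 (l : ℤ)))) • w) =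
      ∑ᶠ p : ℤ × ℤ, (F' p.1 p.2 - G p.1 p.2) • v := by
  set f : ℤ × ℤ → M := fun p => (tz (-((p.1 - p.2) ^ 2) - 2 * p.1 - 2 * p.2) •
    (upow k kinv (p.1 - p.2) * (dp B2 p.1 * dp B1 (p.1 + p.2) * dp B2 p.2))) • w with hf
  have f_zero (p : ℤ × ℤ) (hp : p.1 < 0 ∨ p.2 < 0 ∨ (T0 : ℤ) < p.1 + p.2) : f p = 0 :=
    smul_mul_smul_eq_zero _ _ (dp_mul_dp_mul_dp_smul_eq_zero hw0 hp)
  have f_fin : f.HasFiniteSupport := hasFiniteSupport_of_triangle T0 f_zero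
  have mono_fin {H : ℤ → ℤ → A} {c : ℤ → ℤ → K} {e : ℤ → ℤ → ℤ}
      (hH : H = fun t l => c t l • oddMonomial B1 B2 k kinv (e t l) t l) :
      (fun p : ℤ × ℤ => H p.1 p.2 • v).HasFiniteSupport := by
    refine hasFiniteSupport_of_triangle T0 fun p hp => ?_
    rw [hH]
    exact smul_mul_smul_eq_zero _ _ (dp_mul_dp_mul_dp_smul_eq_zero hv (by omega))
  calc _ = a • ∑ᶠ p, f p := by
        rw [← finsum_natCast_natCast f_fin fun p hp => f_zero p (by tauto)]
    _ = ∑ᶠ p : ℤ × ℤ, (F p.1 p.2 • v + F' (p + (i, j)).1 (p + (i, j)).2 • v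
          - G (p + (r, s)).1 (p + (r, s)).2 • v - F (p + (r, s)).1 (p + (r, s)).2 • v) := by
        rw [smul_finsum' a f_fin]
        refine finsum_congr fun p => ?_
        simp only [hf, hw, Prod.fst_add, Prod.snd_add]
        rw [← mul_smul a, ← mul_smul _ y, hterm, sub_smul, sub_smul, add_smul]
    _ = _ := by
        rw [finsum_telescope (mono_fin hF) (mono_fin hF') (mono_fin hG)]
        simp only [sub_smul]

end Module

end UiAIII

/-- The rank-one intertwining identity (eq. (gB=Bg) in the proof of Theorem 6.4 of the paper):
for a left module `M` over the quasi-split iquantum group Uı of type AIII for sl₃ with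
parameters ς₁ = ς₂ = −q^{1/2}, and a vector `v` such that
`B₂^{(t)}B₁^{(b)}B₂^{(l)}·w = 0` for all `t, l ≥ 0` and `b > T₀`, for `w = v` and
`w = B₁v`, one has
`q^{9/2}·k₁³·Σ_{t,l≥0} q^{−(t−l)²/2−t−l}·k₁^{t−l}·B₂^{(t)}B₁^{(t+l)}B₂^{(l)}·(B₁v)
  = q^{3/2}·B₁·k₁⁻¹·Σ_{t,l≥0} q^{−(t−l)²/2−t−l}·k₁^{t−l}·B₂^{(t)}B₁^{(t+l)}B₂^{(l)}·v`. -/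
theorem statement6 (A : Type*) [Ring A] [Algebra K A]
    (B1 B2 k1 k1' : A)
    (hk : k1 * k1' = 1) (hk' : k1' * k1 = 1)
    (hkB1 : k1 * B1 = tz (-6) • (B1 * k1))
    (hkB2 : k1 * B2 = tz 6 • (B2 * k1))
    (hS1 : B1 ^ 2 * B2 - qint 2 • (B1 * B2 * B1) + B2 * B1 ^ 2
        = qint 2 • (B1 * (tz (-3) • k1 + tz 3 • k1')))
    (hS2 : B2 ^ 2 * B1 - qint 2 • (B2 * B1 * B2) + B1 * B2 ^ 2
        = qint 2 • (B2 * (tz 3 • k1 + tz (-3) • k1')))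
    (M : Type*) [AddCommGroup M] [Module A M]
    (v : M) (T0 : ℕ)
    (hv : ∀ t l b : ℕ, T0 < b →
      (dp B2 (t : ℤ) * dp B1 (b : ℤ) * dp B2 (l : ℤ)) • v = 0)
    (hv' : ∀ t l b : ℕ, T0 < b →
      (dp B2 (t : ℤ) * dp B1 (b : ℤ) * dp B2 (l : ℤ)) • (B1 • v) = 0) :
    (tz 9 • k1 ^ 3) •
        (∑ᶠ t : ℕ, ∑ᶠ l : ℕ,
          ((tz (-(((t : ℤ) - (l : ℤ)) ^ 2) - 2 * (t : ℤ) - 2 * (l : ℤ))) •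
              (upow k1 k1' ((t : ℤ) - (l : ℤ)) *
                (dp B2 (t : ℤ) * dp B1 ((t : ℤ) + (l : ℤ)) * dp B2 (l : ℤ)))) •
            (B1 • v))
      = (tz 3 • (B1 * k1')) •
        (∑ᶠ t : ℕ, ∑ᶠ l : ℕ,
          ((tz (-(((t : ℤ) - (l : ℤ)) ^ 2) - 2 * (t : ℤ) - 2 * (l : ℤ))) •
              (upow k1 k1' ((t : ℤ) - (l : ℤ)) *
                (dp B2 (t : ℤ) * dp B1 ((t : ℤ) + (l : ℤ)) * dp B2 (l : ℤ)))) •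
            v) := by
  have h : IsIquantum B1 B2 k1 k1' := ⟨hk, hk', hkB1, hkB2, hS1, hS2⟩
  rw [smul_finsum_eq_finsum_telescoped (v := v)
      (cF := fun t l => qint (t + 1) * tz (9 - (t - l) ^ 2 - 2 * (t + l)))
      (cF' := fun t l => qint t * tz (4 * (t - l) + 5 - (t - l) ^ 2 - 2 * (t + l)))
      (cG := fun t l => qint (t + 1) * tz (4 * (t - l) + 3 - (t - l) ^ 2 - 2 * (t + l)))
      (pF := fun t l => t - l + 3) (pF' := fun t l => t - l + 1) (pG := fun t l => t - l + 1)
      _ B1 rfl T0 hv hv' rfl rfl rfl 1 (-1) 0 (-1)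
      fun t l => (h.k_pow_smul_term_mul_B1 t l _ _ _ rfl rfl rfl).trans
        (by simp only [add_zero, ← sub_eq_add_neg]),
    smul_finsum_eq_finsum_telescoped (v := v)
      (cF := fun t l => qint (l + 1) * tz (6 * (t - l) - 3 - (t - l) ^ 2 - 2 * (t + l)))
      (cF' := fun t l => qint l * tz (2 * (t - l) + 5 - (t - l) ^ 2 - 2 * (t + l)))
      (cG := fun t l => qint (l + 1) * tz (2 * (t - l) + 3 - (t - l) ^ 2 - 2 * (t + l)))
      (pF := fun t l => t - l - 1) (pF' := fun t l => t - l + 1) (pG := fun t l => t - l + 1)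
      _ 1 (one_smul A v).symm T0 hv hv rfl rfl rfl (-1) 1 (-1) 0
      fun t l => (mul_one _).trans ((h.kinv_smul_term t l _ _ _ rfl rfl rfl).trans
        (by simp only [add_zero, ← sub_eq_add_neg]))]
  refine finsum_congr fun p => ?_
  rw [← sub_smul, ← sub_smul, IsIquantum.telescoped_coeff]
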